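/- arXiv:2511.11875 — 2 statements merged into one kernel-verified Lean document; each statement's English description precedes it below -/
import Mathlib

section
/- (Spike-count bound) Let T > 0 and M > 0 and suppose the input of an integrate-and-fire neuron satisfies f(σ) ≤ M for almost every σ ∈ [0, T]. Then the number of spikes up to time T is bounded by N(T) ≤ 1 + (M·T)/Δ. -/
open MeasureTheory

/-- Spike times of an integrate-and-fire neuron with firing threshold `Δ`, initial state `ξ₀`
and input `f`: `t 0 = 0` and
`t (j+1) = inf { u > t j : ξ_j + ∫_{t j}^{u} f ≥ Δ }` (with `inf ∅ = ⊤`),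
where `ξ_j = ξ₀` for `j = 0` and `ξ_j = 0` for `j ≥ 1`. -/
noncomputable def spikeTime (Δ ξ₀ : ℝ) (f : ℝ → ℝ) : ℕ → EReal
  | 0 => ((0 : ℝ) : EReal)
  | j + 1 =>
      sInf {s : EReal | ∃ u : ℝ, s = (u : EReal) ∧
        spikeTime Δ ξ₀ f j < (u : EReal) ∧
        Δ ≤ (if j = 0 then ξ₀ else 0) + ∫ σ in (spikeTime Δ ξ₀ f j).toReal..u, f σ}

/-- `spikeCount Δ ξ₀ f t` is the number of spikes `N(t) = #{ j ≥ 1 : t_j ≤ t }` fired by the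
integrate-and-fire neuron up to and including time `t`. -/
noncomputable def spikeCount (Δ ξ₀ : ℝ) (f : ℝ → ℝ) (t : ℝ) : ℕ :=
  Set.ncard {j : ℕ | 1 ≤ j ∧ spikeTime Δ ξ₀ f j ≤ (t : EReal)}

/-- The neuron state `ξ(t) = ξ_{N(t)} + ∫_{t_{N(t)}}^{t} f(σ) dσ`. -/
noncomputable def neuronState (Δ ξ₀ : ℝ) (f : ℝ → ℝ) (t : ℝ) : ℝ :=
  (if spikeCount Δ ξ₀ f t = 0 then ξ₀ else 0) +
    ∫ σ in (spikeTime Δ ξ₀ f (spikeCount Δ ξ₀ f t)).toReal..t, f σ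

theorem spikeTime_le_succ (Δ ξ₀ : ℝ) (f : ℝ → ℝ) (j : ℕ) :
    spikeTime Δ ξ₀ f j ≤ spikeTime Δ ξ₀ f (j + 1) := by
  rw [spikeTime]
  refine le_sInf ?_
  rintro s ⟨u, rfl, hu, -⟩
  exact hu.le

theorem spikeTime_nonneg (Δ ξ₀ : ℝ) (f : ℝ → ℝ) (j : ℕ) :
    ((0 : ℝ) : EReal) ≤ spikeTime Δ ξ₀ f j := by
  induction j with
  | zero => rw [spikeTime]
  | succ k ih => exact ih.trans (spikeTime_le_succ Δ ξ₀ f k)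

theorem glb_aux (Δ : ℝ) (hΔ : 0 < Δ) (f : ℝ → ℝ) (a b : ℝ)
    (hb : (b : EReal) = sInf {s : EReal | ∃ u : ℝ, s = (u : EReal) ∧
        (a : EReal) < (u : EReal) ∧ Δ ≤ ∫ σ in a..u, f σ}) :
    Δ ≤ ∫ σ in a..b, f σ := by
  set S := {s : EReal | ∃ u : ℝ, s = (u : EReal) ∧
        (a : EReal) < (u : EReal) ∧ Δ ≤ ∫ σ in a..u, f σ} with hS
  have hne : S.Nonempty := by
    by_contra h
    rw [Set.not_nonempty_iff_eq_empty] at h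
    rw [h, sInf_empty] at hb
    exact EReal.coe_ne_top b hb
  obtain ⟨s, u₀, rfl, hu₀, hI₀⟩ := hne
  have hau : a < u₀ := by exact_mod_cast hu₀
  have hint : IntervalIntegrable f volume a u₀ := by
    by_contra h
    rw [intervalIntegral.integral_undef h] at hI₀
    linarith
  have hcont : ContinuousOn (fun u => ∫ σ in a..u, f σ) (Set.Icc a u₀) := by
    have := intervalIntegral.continuousOn_primitive_interval' hint Set.left_mem_uIcc
    rwa [Set.uIcc_of_le hau.le] at this
  have hcl : IsClosed (Set.Icc a u₀ ∩ (fun u => ∫ σ in a..u, f σ) ⁻¹' Set.Ici Δ) :=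
    hcont.preimage_isClosed_of_isClosed isClosed_Icc isClosed_Ici
  have hglb : IsGLB (Set.Icc a u₀ ∩ (fun u => ∫ σ in a..u, f σ) ⁻¹' Set.Ici Δ) b := by
    constructor
    · rintro u ⟨hu, hu2⟩
      have hne : a ≠ u := by
        rintro rfl
        simp at hu2
        linarith
      have : (b : EReal) ≤ u := by
        rw [hb]
        exact sInf_le ⟨u, rfl, by exact_mod_cast lt_of_le_of_ne hu.1 hne, hu2⟩
      exact_mod_cast this
    · intro c hc
      have : (c : EReal) ≤ b := by
        rw [hb]
        refine le_sInf ?_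
        rintro s ⟨u, rfl, hu, hu2⟩
        have hu' : a < u := by exact_mod_cast hu
        rcases le_total u u₀ with h | h
        · exact_mod_cast hc ⟨⟨hu'.le, h⟩, hu2⟩
        · have h1 := hc ⟨⟨hau.le, le_rfl⟩, hI₀⟩
          exact_mod_cast h1.trans h
      exact_mod_cast this
  have := hcl.closure_eq ▸ hglb.mem_closure ⟨u₀, ⟨hau.le, le_rfl⟩, hI₀⟩
  exact this.2

theorem spikeTime_lower (Δ ξ₀ : ℝ) (hΔ : 0 < Δ)
    (f : ℝ → ℝ) (hf_nonneg : ∀ σ, 0 ≤ f σ) (T M : ℝ) (hM : 0 < M)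
    (hf_bdd : ∀ᵐ σ ∂volume, σ ∈ Set.Icc (0 : ℝ) T → f σ ≤ M) (n : ℕ) :
    ∀ b : ℝ, spikeTime Δ ξ₀ f (n + 1) = b → b ≤ T → n * Δ ≤ M * b := by
  induction n with
  | zero =>
    intro b hb _
    have h := spikeTime_nonneg Δ ξ₀ f (0 + 1)
    rw [hb] at h
    have : 0 ≤ b := by exact_mod_cast h
    simp only [Nat.cast_zero, zero_mul]
    positivity
  | succ k ih =>
    intro b hb hbT
    have h0 := spikeTime_nonneg Δ ξ₀ f (k + 1)
    have h1 := spikeTime_le_succ Δ ξ₀ f (k + 1)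
    rw [hb] at h1
    obtain ⟨a, ha⟩ : ∃ a : ℝ, spikeTime Δ ξ₀ f (k + 1) = a := by
      refine ⟨(spikeTime Δ ξ₀ f (k + 1)).toReal, (EReal.coe_toReal ?_ ?_).symm⟩
      · exact ne_of_lt (h1.trans_lt (EReal.coe_lt_top b))
      · exact ne_of_gt ((EReal.bot_lt_coe 0).trans_le h0)
    rw [ha] at h0 h1
    have h0' : 0 ≤ a := by exact_mod_cast h0
    have hab : a ≤ b := by exact_mod_cast h1
    have hk := ih a ha (hab.trans hbT)
    rw [spikeTime, ha] at hb
    simp only [Nat.add_eq_zero_iff, one_ne_zero, and_false, if_false, zero_add,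
      EReal.toReal_coe] at hb
    have hI := glb_aux Δ hΔ f a b hb.symm
    have hle : ‖∫ σ in a..b, f σ‖ ≤ M * |b - a| := by
      refine intervalIntegral.norm_integral_le_of_norm_le_const_ae ?_
      filter_upwards [hf_bdd] with σ hσ hm
      rw [Set.uIoc_of_le hab] at hm
      rw [Real.norm_of_nonneg (hf_nonneg σ)]
      exact hσ ⟨h0'.trans hm.1.le, hm.2.trans hbT⟩
    rw [abs_of_nonneg (sub_nonneg.2 hab)] at hle
    have := (Real.le_norm_self _).trans hle
    push_cast
    linarith

/-- spike-count bound: if `f ≤ M` a.e. on `[0,T]` then `N(T) ≤ 1 + M·T/Δ`. -/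
theorem spike_count_bound
    (Δ ξ₀ : ℝ) (hΔ : 0 < Δ) (hξ₀ : ξ₀ ∈ Set.Ico 0 Δ)
    (f : ℝ → ℝ) (hf_meas : Measurable f) (hf_nonneg : ∀ σ, 0 ≤ f σ)
    (T M : ℝ) (hT : 0 < T) (hM : 0 < M)
    (hf_bdd : ∀ᵐ σ ∂volume, σ ∈ Set.Icc (0 : ℝ) T → f σ ≤ M) :
    (spikeCount Δ ξ₀ f T : ℝ) ≤ 1 + M * T / Δ := by
  have hsub : {j : ℕ | 1 ≤ j ∧ spikeTime Δ ξ₀ f j ≤ (T : EReal)} ⊆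
      (Finset.Icc 1 (⌊M * T / Δ⌋₊ + 1) : Finset ℕ) := by
    rintro j ⟨hj, hjT⟩
    obtain ⟨n, rfl⟩ : ∃ n, j = n + 1 := ⟨j - 1, by omega⟩
    have h0 := spikeTime_nonneg Δ ξ₀ f (n + 1)
    have hb : spikeTime Δ ξ₀ f (n + 1) = ((spikeTime Δ ξ₀ f (n + 1)).toReal : EReal) := by
      refine (EReal.coe_toReal ?_ ?_).symm
      · exact ne_of_lt (hjT.trans_lt (EReal.coe_lt_top T))
      · exact ne_of_gt ((EReal.bot_lt_coe 0).trans_le h0)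
    have hbT : (spikeTime Δ ξ₀ f (n + 1)).toReal ≤ T := by
      rw [hb] at hjT
      exact_mod_cast hjT
    have h := spikeTime_lower Δ ξ₀ hΔ f hf_nonneg T M hM hf_bdd n _ hb hbT
    have h2 : (n : ℝ) ≤ M * T / Δ := by
      rw [le_div_iff₀ hΔ]
      exact h.trans (mul_le_mul_of_nonneg_left hbT hM.le)
    have h3 := Nat.le_floor h2
    simp only [Finset.coe_Icc, Set.mem_Icc]
    omega
  have hcard := Set.ncard_le_ncard hsub (Finset.finite_toSet _)
  rw [Set.ncard_coe_finset, Nat.card_Icc] at hcard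
  have h4 : (spikeCount Δ ξ₀ f T : ℝ) ≤ (⌊M * T / Δ⌋₊ : ℝ) + 1 := by
    unfold spikeCount
    exact_mod_cast hcard
  have h5 := Nat.floor_le (show 0 ≤ M * T / Δ by positivity)
  linarith
end

section
/- (MIMO per-channel emulation bound) Let y : [0,∞) → ℝ^{n_y} be measurable and locally essentially bounded with components y_j, and let K ∈ ℝ^{n_u×n_y} have all entries K_{ij} ≠ 0. In the MIMO spiking network, for each channel i ∈ {1, …, n_u} and all t ≥ 0, | ∫₀ᵗ ( Σ_{j=1}^{n_y} K_{ij} y_j(s) ) ds − U_i(t) | ≤ Σ_{j=1}^{n_y} ( α_{1,i,j} + α_{2,i,j} ). -/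
open MeasureTheory

lemma spikeTime_char (Δ ξ : ℝ) (f : ℝ → ℝ) (hΔ : 0 < Δ) (hξ : ξ ∈ Set.Ico 0 Δ)
    (hf0 : ∀ s, 0 ≤ f s) (hf : ∀ a b, 0 ≤ a → 0 ≤ b → IntervalIntegrable f volume a b) (j : ℕ) :
    (spikeTime Δ ξ f j = ⊤ ∧ 1 ≤ j ∧ ∀ u, 0 ≤ u → ξ + ∫ σ in (0:ℝ)..u, f σ < j * Δ) ∨
    (∃ T : ℝ, 0 ≤ T ∧ spikeTime Δ ξ f j = (T : EReal) ∧
      (if j = 0 then ξ else 0) + j * Δ = ξ + ∫ σ in (0:ℝ)..T, f σ ∧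
      ∀ u, 0 ≤ u → u < T → ξ + ∫ σ in (0:ℝ)..u, f σ < j * Δ) := by
  have hmono : ∀ a b, 0 ≤ a → a ≤ b → ∫ σ in (0:ℝ)..a, f σ ≤ ∫ σ in (0:ℝ)..b, f σ := by
    intro a b ha hab
    have h1 := intervalIntegral.integral_add_adjacent_intervals (hf 0 a le_rfl ha)
      (hf a b ha (ha.trans hab))
    have h2 : 0 ≤ ∫ σ in a..b, f σ := intervalIntegral.integral_nonneg hab (fun u _ => hf0 u)
    linarith
  induction j with
  | zero =>
    right
    refine ⟨0, le_rfl, by simp [spikeTime], by simp, fun u h1 h2 => by linarith⟩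
  | succ j ih =>
    rcases ih with ⟨htop, hj, hlt⟩ | ⟨T, hT0, hT, hFT, hlt⟩
    · left
      refine ⟨?_, by omega, fun u hu => ?_⟩
      · rw [spikeTime, htop]
        simp
      · have := hlt u hu
        push_cast
        linarith
    · have hset : spikeTime Δ ξ f (j+1) = sInf {s : EReal | ∃ u : ℝ, s = (u : EReal) ∧
          T < u ∧ ((j + 1 : ℕ) : ℝ) * Δ ≤ ξ + ∫ σ in (0:ℝ)..u, f σ} := by
        rw [spikeTime, hT]
        congr 1
        ext s
        simp only [Set.mem_ofPred_eq, EReal.coe_lt_coe_iff, EReal.toReal_coe]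
        refine exists_congr fun u => and_congr_right fun _ => and_congr_right fun hu => ?_
        have h1 := intervalIntegral.integral_add_adjacent_intervals (hf 0 T le_rfl hT0)
          (hf T u hT0 (hT0.trans hu.le))
        push_cast
        constructor <;> intro h <;> linarith
      have hFTlt : ξ + ∫ σ in (0:ℝ)..T, f σ < ((j + 1 : ℕ) : ℝ) * Δ := by
        rw [← hFT]
        push_cast
        have := hξ.2
        split_ifs <;> linarith
      by_cases hex : ∃ u : ℝ, T < u ∧ ((j + 1 : ℕ) : ℝ) * Δ ≤ ξ + ∫ σ in (0:ℝ)..u, f σ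
      · right
        obtain ⟨u₀, hu₀, hc⟩ := hex
        have hcont : ContinuousOn (fun u => ξ + ∫ σ in (0:ℝ)..u, f σ) (Set.Icc T u₀) := by
          refine continuousOn_const.add ?_
          have := intervalIntegral.continuousOn_primitive_interval' (μ := volume) (a := 0)
            (hf 0 u₀ le_rfl (hT0.trans hu₀.le)) Set.left_mem_uIcc
          refine this.mono ?_
          rw [Set.uIcc_of_le (hT0.trans hu₀.le)]
          exact Set.Icc_subset_Icc_left hT0
        obtain ⟨v, hv, hvc⟩ := intermediate_value_Icc hu₀.le hcont ⟨hFTlt.le, hc⟩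
        have hcl : IsCompact (Set.Icc T u₀ ∩ (fun u => ξ + ∫ σ in (0:ℝ)..u, f σ) ⁻¹'
            {((j + 1 : ℕ) : ℝ) * Δ}) :=
          isCompact_Icc.of_isClosed_subset
            (hcont.preimage_isClosed_of_isClosed isClosed_Icc isClosed_singleton)
            Set.inter_subset_left
        obtain ⟨w, ⟨hw1, hw2⟩, hwl⟩ := hcl.exists_isLeast ⟨v, hv, hvc⟩
        simp only [Set.mem_preimage, Set.mem_singleton_iff] at hw2
        have hTw : T < w := lt_of_le_of_ne hw1.1 (by rintro rfl; linarith)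
        have hbelow : ∀ u, 0 ≤ u → u < w →
            ξ + ∫ σ in (0:ℝ)..u, f σ < ((j + 1 : ℕ) : ℝ) * Δ := by
          intro u hu huw
          by_contra! hcon
          rcases lt_or_ge u T with h | h
          · have := hmono u T hu h.le
            linarith
          · have h3 := hmono u w hu huw.le
            have := hwl (a := u) ⟨⟨h, huw.le.trans hw1.2⟩, le_antisymm (by dsimp only; linarith) hcon⟩
            linarith
        refine ⟨w, hT0.trans hTw.le, ?_, ?_, hbelow⟩
        · rw [hset]
          apply IsLeast.csInf_eq
          refine ⟨⟨w, rfl, hTw, hw2.ge⟩, ?_⟩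
          rintro s ⟨u, rfl, hu, huc⟩
          rw [EReal.coe_le_coe_iff]
          by_contra! h
          exact absurd (hbelow u (hT0.trans hu.le) h) (not_lt.mpr huc)
        · rw [if_neg (by omega), zero_add, hw2]
      · left
        push Not at hex
        refine ⟨?_, by omega, fun u hu => ?_⟩
        · rw [hset, sInf_eq_top]
          rintro s ⟨u, rfl, hu, huc⟩
          exact absurd (hex u hu) (not_lt.mpr huc)
        · rcases lt_or_ge T u with h | h
          · exact hex u h
          · have := hmono u T hu h
            linarith

lemma spikeCount_bound (Δ ξ : ℝ) (f : ℝ → ℝ) (hΔ : 0 < Δ) (hξ : ξ ∈ Set.Ico 0 Δ)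
    (hf0 : ∀ s, 0 ≤ f s) (hf : ∀ a b, 0 ≤ a → 0 ≤ b → IntervalIntegrable f volume a b)
    (t : ℝ) (ht : 0 ≤ t) :
    |(∫ σ in (0:ℝ)..t, f σ) - Δ * (spikeCount Δ ξ f t : ℝ)| ≤ Δ := by
  have hI : ∀ a b, 0 ≤ a → a ≤ b → ∫ σ in (0:ℝ)..a, f σ ≤ ∫ σ in (0:ℝ)..b, f σ := by
    intro a b ha hab
    have h1 := intervalIntegral.integral_add_adjacent_intervals (hf 0 a le_rfl ha)
      (hf a b ha (ha.trans hab))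
    have h2 : 0 ≤ ∫ σ in a..b, f σ := intervalIntegral.integral_nonneg hab (fun u _ => hf0 u)
    linarith
  have h0 : 0 ≤ ∫ σ in (0:ℝ)..t, f σ := intervalIntegral.integral_nonneg ht (fun u _ => hf0 u)
  have hnn : 0 ≤ (ξ + ∫ σ in (0:ℝ)..t, f σ) / Δ := div_nonneg (by linarith [hξ.1]) hΔ.le
  have hcount : spikeCount Δ ξ f t = ⌊(ξ + ∫ σ in (0:ℝ)..t, f σ) / Δ⌋₊ := by
    have : {j : ℕ | 1 ≤ j ∧ spikeTime Δ ξ f j ≤ (t : EReal)} =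
        (Finset.Icc 1 ⌊(ξ + ∫ σ in (0:ℝ)..t, f σ) / Δ⌋₊ : Set ℕ) := by
      ext j
      simp only [Set.mem_ofPred_eq, Finset.coe_Icc, Set.mem_Icc]
      refine and_congr_right fun hj => ?_
      rw [Nat.le_floor_iff hnn, le_div_iff₀ hΔ]
      rcases spikeTime_char Δ ξ f hΔ hξ hf0 hf j with ⟨h1, -, h2⟩ | ⟨T, h1, h2, h3, h4⟩
      · rw [h1]
        have := h2 t ht
        simp [this]
      · rw [h2, EReal.coe_le_coe_iff]
        rw [if_neg (by omega)] at h3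
        constructor
        · intro h
          have := hI T t h1 h
          linarith
        · intro h
          by_contra! hc
          exact absurd (h4 t ht hc) (not_lt.mpr h)
    rw [spikeCount, this, Set.ncard_coe_finset]
    simp
  rw [hcount]
  have a1 := Nat.floor_le hnn
  have a2 := Nat.lt_floor_add_one ((ξ + ∫ σ in (0:ℝ)..t, f σ) / Δ)
  rw [le_div_iff₀ hΔ] at a1
  rw [div_lt_iff₀ hΔ] at a2
  have := hξ.1
  have := hξ.2
  rw [abs_le]
  constructor <;> linarith

/-- MIMO per-channel emulation bound: for each channel `i`, the cumulative
spiking output `U_i(t) = Σ_j sign(K i j)(α₁ᵢⱼ N₁ᵢⱼ(t) − α₂ᵢⱼ N₂ᵢⱼ(t))` of the MIMO network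
approximates `∫₀ᵗ Σ_j K i j · y_j(s) ds` to within `Σ_j (α₁ᵢⱼ + α₂ᵢⱼ)`. -/
theorem mimo_per_channel_emulation_bound
    (nu ny : ℕ) (K : Fin nu → Fin ny → ℝ) (hK : ∀ i j, K i j ≠ 0)
    (α₁ α₂ Δ₁ Δ₂ ξ₁ ξ₂ : Fin nu → Fin ny → ℝ)
    (hα₁ : ∀ i j, 0 < α₁ i j) (hα₂ : ∀ i j, 0 < α₂ i j)
    (hΔ₁ : ∀ i j, 0 < Δ₁ i j) (hΔ₂ : ∀ i j, 0 < Δ₂ i j)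
    (hK₁ : ∀ i j, |K i j| = α₁ i j / Δ₁ i j)
    (hK₂ : ∀ i j, |K i j| = α₂ i j / Δ₂ i j)
    (hξ₁ : ∀ i j, ξ₁ i j ∈ Set.Ico 0 (Δ₁ i j))
    (hξ₂ : ∀ i j, ξ₂ i j ∈ Set.Ico 0 (Δ₂ i j))
    (y : Fin ny → ℝ → ℝ) (hy_meas : ∀ j, Measurable (y j))
    (hy_bdd : ∀ j, ∀ T : ℝ, 0 < T →
      ∃ M : ℝ, ∀ᵐ s ∂volume, s ∈ Set.Icc (0 : ℝ) T → |y j s| ≤ M) :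
    ∀ i : Fin nu, ∀ t : ℝ, 0 ≤ t →
      |(∫ s in (0 : ℝ)..t, ∑ j, K i j * y j s) -
          ∑ j, Real.sign (K i j) *
            (α₁ i j * (spikeCount (Δ₁ i j) (ξ₁ i j) (fun s => max 0 (y j s)) t : ℝ) -
              α₂ i j * (spikeCount (Δ₂ i j) (ξ₂ i j) (fun s => max 0 (-(y j s))) t : ℝ))| ≤
        ∑ j, (α₁ i j + α₂ i j) := by
  intro i t ht
  have hint : ∀ j, ∀ a b, 0 ≤ a → 0 ≤ b → IntervalIntegrable (y j) volume a b := by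
    intro j a b ha hb
    obtain ⟨M, hM⟩ := hy_bdd j (max a b + 1) (by positivity)
    rw [intervalIntegrable_iff]
    refine Measure.integrableOn_of_bounded (M := M) (by simp) (hy_meas j).aestronglyMeasurable ?_
    rw [ae_restrict_iff' measurableSet_uIoc]
    filter_upwards [hM] with s hs hmem
    rw [Set.uIoc, Set.mem_Ioc] at hmem
    exact hs ⟨(le_min ha hb).trans hmem.1.le, by linarith [hmem.2]⟩
  rw [intervalIntegral.integral_finsetSum (fun j _ => (hint j 0 t le_rfl ht).const_mul _),
    ← Finset.sum_sub_distrib]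
  refine (Finset.abs_sum_le_sum_abs _ _).trans (Finset.sum_le_sum fun j _ => ?_)
  have hp : ∀ a b, 0 ≤ a → 0 ≤ b →
      IntervalIntegrable (fun s => max 0 (y j s)) volume a b := by
    intro a b ha hb
    have h := intervalIntegrable_iff.mp (hint j a b ha hb)
    rw [intervalIntegrable_iff]
    simpa only [max_comm, IntegrableOn] using Integrable.pos_part h
  have hq : ∀ a b, 0 ≤ a → 0 ≤ b →
      IntervalIntegrable (fun s => max 0 (-(y j s))) volume a b := by
    intro a b ha hb
    have h := intervalIntegrable_iff.mp (hint j a b ha hb)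
    rw [intervalIntegrable_iff]
    simpa only [max_comm, IntegrableOn] using Integrable.neg_part h
  have b1 := spikeCount_bound (Δ₁ i j) (ξ₁ i j) _ (hΔ₁ i j) (hξ₁ i j)
    (fun s => le_max_left 0 (y j s)) hp t ht
  have b2 := spikeCount_bound (Δ₂ i j) (ξ₂ i j) _ (hΔ₂ i j) (hξ₂ i j)
    (fun s => le_max_left 0 (-(y j s))) hq t ht
  have hsplit : ∫ s in (0:ℝ)..t, y j s =
      (∫ s in (0:ℝ)..t, max 0 (y j s)) - ∫ s in (0:ℝ)..t, max 0 (-(y j s)) := by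
    rw [← intervalIntegral.integral_sub (hp 0 t le_rfl ht) (hq 0 t le_rfl ht)]
    congr 1
    ext s
    rcases le_total 0 (y j s) with h | h
    · rw [max_eq_right h, max_eq_left (by linarith)]; ring
    · rw [max_eq_left h, max_eq_right (by linarith)]; ring
  rw [intervalIntegral.integral_const_mul, hsplit]
  set P := ∫ s in (0:ℝ)..t, max 0 (y j s)
  set Q := ∫ s in (0:ℝ)..t, max 0 (-(y j s))
  generalize (spikeCount (Δ₁ i j) (ξ₁ i j) (fun s => max 0 (y j s)) t : ℝ) = N₁ at *
  generalize (spikeCount (Δ₂ i j) (ξ₂ i j) (fun s => max 0 (-(y j s))) t : ℝ) = N₂ at *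
  have e1 : α₁ i j = |K i j| * Δ₁ i j := by
    rw [hK₁, div_mul_cancel₀ _ (hΔ₁ i j).ne']
  have e2 : α₂ i j = |K i j| * Δ₂ i j := by
    rw [hK₂, div_mul_cancel₀ _ (hΔ₂ i j).ne']
  have hs : K i j = Real.sign (K i j) * |K i j| := by
    rcases lt_or_gt_of_ne (hK i j) with h | h
    · rw [Real.sign_of_neg h, abs_of_neg h]; ring
    · rw [Real.sign_of_pos h, abs_of_pos h]; ring
  have hs1 : |Real.sign (K i j)| = 1 := by
    rcases lt_or_gt_of_ne (hK i j) with h | h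
    · rw [Real.sign_of_neg h]; simp
    · rw [Real.sign_of_pos h]; simp
  have e3 : K i j * (P - Q) - Real.sign (K i j) * (α₁ i j * N₁ - α₂ i j * N₂) =
      Real.sign (K i j) * (|K i j| * ((P - Δ₁ i j * N₁) - (Q - Δ₂ i j * N₂))) := by
    rw [e1, e2]
    linear_combination (P - Q) * hs
  rw [e3, abs_mul, hs1, one_mul, abs_mul, abs_abs, e1, e2, ← mul_add]
  exact mul_le_mul_of_nonneg_left ((abs_sub _ _).trans (add_le_add b1 b2)) (abs_nonneg _)
end
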